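/- Let k and k' be integers with 2 ≤ k' ≤ k, and let x_1 ≤ x_2 ≤ … ≤ x_{k'} be real numbers with R := x_{k'} − x_1 > 0. For t ∈ ℝ define f(t) = min(#{i : x_i ≤ t}, #{i : x_i ≥ t}), which satisfies f(t) ≥ 1 for t ∈ [x_1, x_{k'}]. Then the Lebesgue measure of the set {t ∈ [x_1, x_{k'}] : there exists i ∈ {1,…,k'} with |t − x_i| < R/(10·(ln k)·f(t))} is at most (2/3)·R. -/

import Mathlib

open Finset MeasureTheory

lemma aux_harm (n : ℕ) : ∑ i ∈ range n, (1 / ((i : ℝ) + 1)) ≤ 5 / 3 * Real.log ((n : ℝ) + 1) := by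
  induction n with
  | zero => simp
  | succ n ih =>
    rw [sum_range_succ]
    have hn : (0 : ℝ) < (n : ℝ) + 1 := by positivity
    have h := Real.le_log_one_add_of_nonneg (x := 1 / ((n : ℝ) + 1)) (by positivity)
    have h1 : Real.log (((n + 1 : ℕ) : ℝ) + 1)
        = Real.log ((n : ℝ) + 1) + Real.log (1 + 1 / ((n : ℝ) + 1)) := by
      rw [← Real.log_mul hn.ne' (by positivity)]
      congr 1
      push_cast
      field_simp
    rw [h1]
    have h2 : 1 / ((n : ℝ) + 1) ≤ 5 / 3 * (2 * (1 / ((n : ℝ) + 1)) / (1 / ((n : ℝ) + 1) + 2)) := by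
      have : 2 * (1 / ((n : ℝ) + 1)) / (1 / ((n : ℝ) + 1) + 2) = 2 / (2 * n + 3) := by
        field_simp
        ring
      rw [this, ← mul_div_assoc, div_le_div_iff₀ hn (by positivity)]
      nlinarith [(Nat.cast_nonneg n : (0 : ℝ) ≤ n)]
    linarith

lemma aux_sum (m : ℕ) : ∑ n : Fin m, (1 / ((n : ℝ) + 1) + 1 / ((m : ℝ) - n))
    ≤ 10 / 3 * Real.log ((m : ℝ) + 1) := by
  have h0 := aux_harm m
  have h1 := Fin.sum_univ_eq_sum_range (fun n => 1 / ((n : ℝ) + 1) + 1 / ((m : ℝ) - n)) m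
  rw [h1, sum_add_distrib]
  have h2 : ∑ n ∈ range m, 1 / ((m : ℝ) - n) = ∑ i ∈ range m, (1 / ((i : ℝ) + 1)) := by
    rw [← sum_range_reflect]
    apply sum_congr rfl
    intro j hj
    rw [Finset.mem_range] at hj
    congr 1
    have : m - 1 - j + (1 + j) = m := by omega
    have h3 : ((m - 1 - j : ℕ) : ℝ) + (1 + j) = m := by exact_mod_cast this
    linarith
  rw [h2]
  linarith

lemma aux_cover (m : ℕ) (c : ℝ) (hc : 0 ≤ c) (x : Fin (m + 1) → ℝ) (hmono : Monotone x) (t : ℝ)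
    (h0 : x 0 ≤ t) (h1 : t ≤ x (Fin.last m)) (hx : t ∉ Set.range x)
    (h : ∃ i, |t - x i| < c / ((min (univ.filter (fun j => x j ≤ t)).card
                  (univ.filter (fun j => t ≤ x j)).card : ℕ) : ℝ)) :
    ∃ n : Fin m, t ∈ Set.Icc (x n.castSucc)
        (x n.castSucc + c * (1 / ((n : ℝ) + 1) + 1 / ((m : ℝ) - n))) ∪
      Set.Icc (x n.succ - c * (1 / ((n : ℝ) + 1) + 1 / ((m : ℝ) - n))) (x n.succ) := by
  have hne : ∀ j, x j ≠ t := fun j hj => hx ⟨j, hj⟩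
  have hS : (univ.filter (fun j => t < x j)).Nonempty :=
    ⟨Fin.last m, by simp [lt_of_le_of_ne h1 (hne _).symm]⟩
  obtain ⟨p, hp⟩ : ∃ p, p = (univ.filter (fun j => t < x j)).min' hS := ⟨_, rfl⟩
  have hpt : t < x p := by
    have := Finset.min'_mem _ hS
    rw [← hp] at this
    simpa using this
  have hiff : ∀ j, t < x j ↔ p ≤ j := by
    intro j
    constructor
    · intro hj
      rw [hp]
      exact Finset.min'_le _ _ (by simpa using hj)
    · intro hj
      exact hpt.trans_le (hmono hj)
  have hp0 : p ≠ 0 := by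
    rintro rfl
    linarith
  obtain ⟨n, rfl⟩ := Fin.exists_succ_eq.mpr hp0
  have e1 : univ.filter (fun j => x j ≤ t) = Finset.Iio n.succ := by
    ext j
    have := hiff j
    simp only [Finset.mem_filter, Finset.mem_univ, true_and, Finset.mem_Iio]
    rw [← not_lt, this, not_le]
  have e2 : univ.filter (fun j => t ≤ x j) = Finset.Ici n.succ := by
    ext j
    have := hiff j
    simp only [Finset.mem_filter, Finset.mem_univ, true_and, Finset.mem_Ici]
    rw [← this]
    exact ⟨fun h => lt_of_le_of_ne h (hne j).symm, le_of_lt⟩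
  rw [e1, e2, Fin.card_Iio, Fin.card_Ici] at h
  obtain ⟨i, hi⟩ := h
  have hnm := n.isLt
  have hnm' : ((n : ℕ) : ℝ) < m := by exact_mod_cast hnm
  have hpos1 : 0 ≤ 1 / ((n : ℝ) + 1) := by positivity
  have hpos2 : 0 ≤ 1 / ((m : ℝ) - n) := by
    apply one_div_nonneg.mpr
    linarith
  have hr : c / ((min (n.succ : ℕ) (m + 1 - (n.succ : ℕ)) : ℕ) : ℝ)
      ≤ c * (1 / ((n : ℝ) + 1) + 1 / ((m : ℝ) - n)) := by
    rw [div_eq_mul_one_div]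
    apply mul_le_mul_of_nonneg_left _ hc
    rcases min_choice (n.succ : ℕ) (m + 1 - (n.succ : ℕ)) with h | h
    · rw [h]
      simp only [Fin.val_succ]
      push_cast
      linarith
    · rw [h]
      have : m + 1 - (n.succ : ℕ) = m - n := by simp
      rw [this, Nat.cast_sub hnm.le]
      linarith
  have hi2 := abs_lt.mp (hi.trans_le hr)
  refine ⟨n, ?_⟩
  by_cases hin : n.succ ≤ i
  · right
    have := hmono hin
    exact ⟨by linarith, hpt.le⟩
  · left
    have hin' : i ≤ n.castSucc := by
      rw [not_le] at hin
      exact Fin.le_castSucc_iff.mpr hin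
    have := hmono hin'
    have h3 : x n.castSucc ≤ t := by
      rw [← not_lt, hiff]
      simp
    exact ⟨h3, by linarith⟩

/-- For `2 ≤ k' ≤ k` and sorted reals `x_1 ≤ … ≤ x_{k'}` with `R = x_{k'} − x_1 > 0`,
the Lebesgue measure of the set of `t ∈ [x_1, x_{k'}]` lying within distance
`R / (10 (ln k) f(t))` of some `x_i`, where
`f(t) = min(#{i : x_i ≤ t}, #{i : x_i ≥ t})`, is at most `(2/3) R`. -/
theorem stmt_2 (k k' : ℕ) (hk' : 2 ≤ k') (hkk : k' ≤ k)
    (x : Fin k' → ℝ) (hmono : Monotone x)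
    (R : ℝ) (hR : R = x ⟨k' - 1, by omega⟩ - x ⟨0, by omega⟩) (hRpos : 0 < R) :
    volume {t ∈ Set.Icc (x ⟨0, by omega⟩) (x ⟨k' - 1, by omega⟩) |
        ∃ i : Fin k', |t - x i| <
          R / (10 * Real.log k *
            ((min (univ.filter (fun j : Fin k' => x j ≤ t)).card
                  (univ.filter (fun j : Fin k' => t ≤ x j)).card : ℕ) : ℝ))}
      ≤ ENNReal.ofReal ((2 / 3) * R) := by
  obtain ⟨m, rfl⟩ : ∃ m, k' = m + 1 := ⟨k' - 1, by omega⟩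
  have hm : 1 ≤ m := by omega
  have hlogm : 0 < Real.log ((m : ℝ) + 1) := Real.log_pos (by
    have : (1 : ℝ) ≤ m := by exact_mod_cast hm
    linarith)
  have hlog : Real.log ((m : ℝ) + 1) ≤ Real.log k := by
    apply Real.log_le_log (by positivity)
    exact_mod_cast hkk
  have hL : 0 < Real.log k := by linarith
  obtain ⟨c, hcdef⟩ : ∃ c, c = R / (10 * Real.log k) := ⟨_, rfl⟩
  have hc : 0 < c := by rw [hcdef]; positivity
  let r : Fin m → ℝ := fun n => c * (1 / ((n : ℝ) + 1) + 1 / ((m : ℝ) - n))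
  have hr0 : ∀ n, 0 ≤ r n := by
    intro n
    have hnm' : ((n : ℕ) : ℝ) < m := by exact_mod_cast n.isLt
    have hpos1 : 0 ≤ 1 / ((n : ℝ) + 1) := by positivity
    have hpos2 : 0 ≤ 1 / ((m : ℝ) - n) := by
      apply one_div_nonneg.mpr
      linarith
    exact mul_nonneg hc.le (by linarith)
  let A : Fin m → Set ℝ := fun n => Set.Icc (x n.castSucc) (x n.castSucc + r n) ∪
    Set.Icc (x n.succ - r n) (x n.succ)
  have hA : ∀ n, volume (A n) ≤ ENNReal.ofReal (2 * r n) := by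
    intro n
    refine (measure_union_le _ _).trans ?_
    rw [Real.volume_Icc, Real.volume_Icc, ← ENNReal.ofReal_add (by linarith [hr0 n]) (by linarith [hr0 n])]
    apply ENNReal.ofReal_le_ofReal
    linarith
  have hsum : ∑ n, 2 * r n ≤ 2 / 3 * R := by
    rw [← mul_sum, ← mul_sum]
    have h1 := aux_sum m
    have h2 := mul_le_mul_of_nonneg_left (h1.trans (mul_le_mul_of_nonneg_left hlog (by norm_num))) hc.le
    have h3 : c * (10 / 3 * Real.log k) = R / 3 := by
      rw [hcdef]
      field_simp
    linarith
  have hsub : ∀ T : Set ℝ, T ⊆ Set.range x ∪ ⋃ n, A n → volume T ≤ ENNReal.ofReal (2 / 3 * R) := by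
    intro T hT
    calc volume T ≤ volume (Set.range x ∪ ⋃ n, A n) := measure_mono hT
      _ ≤ volume (Set.range x) + volume (⋃ n, A n) := measure_union_le _ _
      _ = volume (⋃ n, A n) := by
        rw [(Set.finite_range x).measure_zero, zero_add]
      _ ≤ ∑ n, volume (A n) := measure_iUnion_fintype_le _ _
      _ ≤ ∑ n, ENNReal.ofReal (2 * r n) := sum_le_sum fun n _ => hA n
      _ = ENNReal.ofReal (∑ n, 2 * r n) :=
        (ENNReal.ofReal_sum_of_nonneg fun n _ => by linarith [hr0 n]).symm
      _ ≤ _ := ENNReal.ofReal_le_ofReal hsum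
  apply hsub
  rintro t ⟨⟨ht0, ht1⟩, hi⟩
  by_cases hx : t ∈ Set.range x
  · exact Or.inl hx
  · right
    rw [Set.mem_iUnion]
    refine aux_cover m c hc.le x hmono t ht0 ht1 hx ?_
    obtain ⟨i, hi⟩ := hi
    refine ⟨i, ?_⟩
    rw [hcdef, div_div]
    exact hi
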